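/- arXiv:2510.01675 — 7 statements merged into one kernel-verified Lean document; each statement's English description precedes it below -/
import Mathlib

section
/- Let $Q \in SO(3)$, let $e = \tfrac{1}{2}(Q - Q^\top)^\vee \in \mathbb{R}^3$, and let $\Psi = \tfrac{1}{2}\operatorname{tr}(I_3 - Q)$. If $\Psi \le \psi_2$ for some constant $\psi_2 < 2$, then $\Psi \le \frac{1}{2 - \psi_2}\|e\|^2$. -/
open Matrix

/-- The inverse of the hat map: takes a 3×3 skew-symmetric matrix to a vector in `ℝ³`. -/
def vee (A : Matrix (Fin 3) (Fin 3) ℝ) : Fin 3 → ℝ := ![A 2 1, A 0 2, A 1 0]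

/-- A matrix with `Qᵀ * Q = 1` and determinant one has adjugate `Qᵀ`. -/
theorem adjugate_eq_transpose_of_det_eq_one {n R : Type*} [Fintype n] [DecidableEq n]
    [CommRing R] {Q : Matrix n n R} (hQ : Qᵀ * Q = 1) (hdet : Q.det = 1) :
    Q.adjugate = Qᵀ := by
  calc Q.adjugate = Qᵀ * Q * Q.adjugate := by rw [hQ, one_mul]
    _ = Qᵀ := by rw [mul_assoc, mul_adjugate, hdet, one_smul, mul_one]

/-- For a rotation, `‖e‖² = Ψ (2 - Ψ)`. -/
theorem vee_dotProduct_self_of_rotation {Q : Matrix (Fin 3) (Fin 3) ℝ}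
    (hQ : Qᵀ * Q = 1) (hdet : Q.det = 1) :
    ((1/2 : ℝ) • vee (Q - Qᵀ)) ⬝ᵥ ((1/2 : ℝ) • vee (Q - Qᵀ)) =
      (1/2) * trace (1 - Q) * (2 - (1/2) * trace (1 - Q)) := by
  have hadj := adjugate_eq_transpose_of_det_eq_one hQ hdet
  rw [adjugate_fin_three] at hadj
  have a0 := congrFun (congrFun hadj 0) 0
  have a1 := congrFun (congrFun hadj 1) 1
  have a2 := congrFun (congrFun hadj 2) 2
  have c0 := congrFun (congrFun hQ 0) 0
  have c1 := congrFun (congrFun hQ 1) 1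
  have c2 := congrFun (congrFun hQ 2) 2
  simp [mul_apply, Fin.sum_univ_three] at a0 a1 a2 c0 c1 c2
  simp [vee, dotProduct, trace, Fin.sum_univ_three]
  linear_combination (1/4) * (c0 + c1 + c2) + (1/2) * (a0 + a1 + a2)

/-- The trace of `1 - Q` is nonnegative when the columns of `Q` are orthonormal. -/
theorem trace_one_sub_nonneg {n : Type*} [Fintype n] [DecidableEq n] {Q : Matrix n n ℝ}
    (hQ : Qᵀ * Q = 1) : 0 ≤ trace (1 - Q) := by
  refine Finset.sum_nonneg fun i _ => ?_
  have h := congrFun (congrFun hQ i) i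
  simp only [mul_apply, transpose_apply, one_apply_eq] at h
  have hle := Finset.single_le_sum (f := fun j => Q j i * Q j i)
    (fun j _ => mul_self_nonneg _) (Finset.mem_univ i)
  simp only [diag_apply, Matrix.sub_apply, one_apply_eq]
  nlinarith

theorem stmt2 (Q : Matrix (Fin 3) (Fin 3) ℝ) (hQ : Qᵀ * Q = 1) (hdet : Q.det = 1)
    (ψ2 : ℝ) (hψ2 : ψ2 < 2)
    (hΨ : (1/2) * Matrix.trace ((1 : Matrix (Fin 3) (Fin 3) ℝ) - Q) ≤ ψ2) :
    let e : Fin 3 → ℝ := (1/2 : ℝ) • vee (Q - Qᵀ)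
    (1/2) * Matrix.trace ((1 : Matrix (Fin 3) (Fin 3) ℝ) - Q) ≤ (1/(2 - ψ2)) * (e ⬝ᵥ e) := by
  intro e
  have hnonneg := trace_one_sub_nonneg hQ
  rw [show e ⬝ᵥ e = _ from vee_dotProduct_self_of_rotation hQ hdet, one_div_mul_eq_div (2 - ψ2),
    le_div_iff₀ (by linarith)]
  exact mul_le_mul_of_nonneg_left (by linarith) (by linarith)
end

section
/- Let $J$ be a symmetric positive-definite $3\times 3$ real matrix with smallest and largest eigenvalues $\lambda_{\min}(J)$ and $\lambda_{\max}(J)$, let $k_{rp} > 0$ and $c_2 > 0$, let $R, R_d \in SO(3)$, and let $e_\omega \in \mathbb{R}^3$. Set $\Psi = \tfrac{1}{2}\operatorname{tr}(I_3 - R_d^\top R)$ and $e_R = \tfrac{1}{2}(R_d^\top R - R^\top R_d)^\vee$, and assume $\Psi \le \psi_2$ for some constant $\psi_2 < 2$. Define $V_2' = \tfrac{1}{2} e_\omega^\top J e_\omega + k_{rp} \Psi + c_2 e_R^\top e_\omega$ and $z_2 = (\|e_R\|, \|e_\omega\|)^\top$. Then $z_2^\top M_{21} z_2 \le V_2' \le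 z_2^\top M_{22} z_2$, where $M_{21} = \tfrac{1}{2}\begin{pmatrix} k_{rp} & -c_2 \\ -c_2 & \lambda_{\min}(J) \end{pmatrix}$ and $M_{22} = \tfrac{1}{2}\begin{pmatrix} \tfrac{2 k_{rp}}{2 - \psi_2} & c_2 \\ c_2 & \lambda_{\max}(J) \end{pmatrix}$. -/
open Matrix

/-- Euclidean norm of a vector in `ℝ³`. -/
noncomputable def norm3 (v : Fin 3 → ℝ) : ℝ := Real.sqrt (v ⬝ᵥ v)

/-- Membership in `SO(3)`: orthogonal with determinant one. -/
def SO3 (Q : Matrix (Fin 3) (Fin 3) ℝ) : Prop := Qᵀ * Q = 1 ∧ Q.det = 1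

lemma norm3_nonneg (v : Fin 3 → ℝ) : 0 ≤ norm3 v := Real.sqrt_nonneg _

lemma norm3_mul_self (v : Fin 3 → ℝ) : norm3 v * norm3 v = v ⬝ᵥ v :=
  Real.mul_self_sqrt (by simpa using dotProduct_star_self_nonneg v)

lemma abs_dotProduct_le_norm3_mul_norm3 (u v : Fin 3 → ℝ) :
    |u ⬝ᵥ v| ≤ norm3 u * norm3 v := by
  refine abs_le_of_sq_le_sq ?_ (mul_nonneg (norm3_nonneg u) (norm3_nonneg v))
  have h : (norm3 u * norm3 v) ^ 2 = (u ⬝ᵥ u) * (v ⬝ᵥ v) := by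
    rw [← norm3_mul_self u, ← norm3_mul_self v]; ring
  rw [h]
  simp only [dotProduct, Fin.sum_univ_three]
  nlinarith [sq_nonneg (u 0 * v 1 - u 1 * v 0), sq_nonneg (u 0 * v 2 - u 2 * v 0),
    sq_nonneg (u 1 * v 2 - u 2 * v 1)]

namespace SO3

variable {P Q : Matrix (Fin 3) (Fin 3) ℝ}

lemma transpose_mul (hP : SO3 P) (hQ : SO3 Q) : SO3 (Pᵀ * Q) := by
  refine ⟨?_, by simp [det_mul, det_transpose, hP.2, hQ.2]⟩
  rw [Matrix.transpose_mul, transpose_transpose, Matrix.mul_assoc, ← Matrix.mul_assoc P,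
    mul_eq_one_comm.mp hP.1, Matrix.one_mul, hQ.1]

lemma adjugate_eq_transpose (hQ : SO3 Q) : Q.adjugate = Qᵀ := by
  have h := Q.mul_adjugate
  rw [hQ.2, one_smul] at h
  calc Q.adjugate = Qᵀ * Q * Q.adjugate := by rw [hQ.1, Matrix.one_mul]
    _ = Qᵀ := by rw [Matrix.mul_assoc, h, Matrix.mul_one]

lemma col_sum_sq (hQ : SO3 Q) (j : Fin 3) :
    Q 0 j ^ 2 + Q 1 j ^ 2 + Q 2 j ^ 2 = 1 := by
  have h := congrFun (congrFun hQ.1 j) j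
  simp only [mul_apply, transpose_apply, Fin.sum_univ_three, one_apply_eq] at h
  linarith

lemma trace_le_three (hQ : SO3 Q) : Q.trace ≤ 3 := by
  rw [trace_fin_three]
  nlinarith [hQ.col_sum_sq 0, hQ.col_sum_sq 1, hQ.col_sum_sq 2,
    sq_nonneg (Q 0 0 - 1), sq_nonneg (Q 1 1 - 1), sq_nonneg (Q 2 2 - 1),
    sq_nonneg (Q 1 0), sq_nonneg (Q 2 0), sq_nonneg (Q 0 1), sq_nonneg (Q 2 1),
    sq_nonneg (Q 0 2), sq_nonneg (Q 1 2)]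

lemma vee_sub_transpose_dotProduct_self (hQ : SO3 Q) :
    vee (Q - Qᵀ) ⬝ᵥ vee (Q - Qᵀ) = (3 - Q.trace) * (1 + Q.trace) := by
  have hadj := hQ.adjugate_eq_transpose
  rw [adjugate_fin_three] at hadj
  have h0 := congrFun (congrFun hadj 0) 0
  have h1 := congrFun (congrFun hadj 1) 1
  have h2 := congrFun (congrFun hadj 2) 2
  simp only [of_apply, cons_val, transpose_apply] at h0 h1 h2
  simp only [vee, dotProduct, Fin.sum_univ_three, trace_fin_three, Matrix.sub_apply,
    transpose_apply, cons_val]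
  linear_combination hQ.col_sum_sq 0 + hQ.col_sum_sq 1
    + hQ.col_sum_sq 2 + 2 * h0 + 2 * h1 + 2 * h2

end SO3

theorem stmt3 (J : Matrix (Fin 3) (Fin 3) ℝ) (hJsym : J.IsSymm)
    (hJpd : ∀ v : Fin 3 → ℝ, v ≠ 0 → 0 < v ⬝ᵥ J.mulVec v)
    (lmin lmax : ℝ)
    -- `lmin` is the smallest eigenvalue of `J`
    (hlmin_le : ∀ v : Fin 3 → ℝ, lmin * (v ⬝ᵥ v) ≤ v ⬝ᵥ J.mulVec v)
    (hlmin_eig : ∃ v : Fin 3 → ℝ, v ≠ 0 ∧ J.mulVec v = lmin • v)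
    -- `lmax` is the largest eigenvalue of `J`
    (hlmax_ge : ∀ v : Fin 3 → ℝ, v ⬝ᵥ J.mulVec v ≤ lmax * (v ⬝ᵥ v))
    (hlmax_eig : ∃ v : Fin 3 → ℝ, v ≠ 0 ∧ J.mulVec v = lmax • v)
    (krp c2 : ℝ) (hkrp : 0 < krp) (hc2 : 0 < c2)
    (R Rd : Matrix (Fin 3) (Fin 3) ℝ) (hR : SO3 R) (hRd : SO3 Rd)
    (eω : Fin 3 → ℝ) (ψ2 : ℝ) (hψ2 : ψ2 < 2)
    (hΨ : (1/2) * Matrix.trace ((1 : Matrix (Fin 3) (Fin 3) ℝ) - Rdᵀ * R) ≤ ψ2) :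
    let Ψ : ℝ := (1/2) * Matrix.trace ((1 : Matrix (Fin 3) (Fin 3) ℝ) - Rdᵀ * R)
    let eR : Fin 3 → ℝ := (1/2 : ℝ) • vee (Rdᵀ * R - Rᵀ * Rd)
    let V2 : ℝ := (1/2) * (eω ⬝ᵥ J.mulVec eω) + krp * Ψ + c2 * (eR ⬝ᵥ eω)
    let z2 : Fin 2 → ℝ := ![norm3 eR, norm3 eω]
    let M21 : Matrix (Fin 2) (Fin 2) ℝ := (1/2 : ℝ) • !![krp, -c2; -c2, lmin]
    let M22 : Matrix (Fin 2) (Fin 2) ℝ := (1/2 : ℝ) • !![2 * krp / (2 - ψ2), c2; c2, lmax]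
    z2 ⬝ᵥ M21.mulVec z2 ≤ V2 ∧ V2 ≤ z2 ⬝ᵥ M22.mulVec z2 := by
  intro Ψ eR V2 z2 M21 M22
  have hQ : SO3 (Rdᵀ * R) := hRd.transpose_mul hR
  have hΨ_trace : Ψ = (1 / 2) * (3 - (Rdᵀ * R).trace) := by
    simp [Ψ, trace_sub]
  have hΨ_le : Ψ ≤ ψ2 := hΨ
  have hΨ_nonneg : 0 ≤ Ψ := by linarith [hQ.trace_le_three]
  have heR : norm3 eR * norm3 eR = Ψ * (2 - Ψ) := by
    have h := hQ.vee_sub_transpose_dotProduct_self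
    rw [Matrix.transpose_mul, transpose_transpose] at h
    rw [norm3_mul_self, hΨ_trace]
    simp only [eR, smul_dotProduct, dotProduct_smul, h, smul_eq_mul]
    ring
  have heω := norm3_mul_self eω
  have hmin := hlmin_le eω
  have hmax := hlmax_ge eω
  rw [← heω] at hmin hmax
  obtain ⟨hcross_ge, hcross_le⟩ := abs_le.mp (abs_dotProduct_le_norm3_mul_norm3 eR eω)
  have hcross_ge' := mul_le_mul_of_nonneg_left hcross_ge hc2.le
  have hcross_le' := mul_le_mul_of_nonneg_left hcross_le hc2.le
  have hquad (a b c : ℝ) : z2 ⬝ᵥ ((1 / 2 : ℝ) • !![a, b; b, c]).mulVec z2 =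
      (1 / 2) * (a * (norm3 eR * norm3 eR)) + b * (norm3 eR * norm3 eω)
        + (1 / 2) * (c * (norm3 eω * norm3 eω)) := by
    simp [z2, mulVec, dotProduct, Fin.sum_univ_two]
    ring
  constructor
  · rw [hquad, heR]
    have : krp * (Ψ * (2 - Ψ)) ≤ 2 * (krp * Ψ) := by nlinarith [mul_nonneg hkrp.le (sq_nonneg Ψ)]
    simp only [V2]
    linarith
  · rw [hquad, heR]
    have : 2 * (krp * Ψ) ≤ 2 * krp / (2 - ψ2) * (Ψ * (2 - Ψ)) := by
      rw [div_mul_eq_mul_div, le_div_iff₀ (by linarith)]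
      nlinarith [mul_nonneg (mul_nonneg hkrp.le hΨ_nonneg) (sub_nonneg.mpr hΨ_le)]
    simp only [V2]
    linarith
end

section
/- Let $k > 0$, $\sigma > 0$, and $\Delta \in \mathbb{R}$ with $|\Delta| < k\sigma$. Define $g : \mathbb{R} \to \mathbb{R}$ by $g(e) = \int_{\Delta/k}^{e} (k\,\mathrm{sat}_{\sigma}(\gamma) - \Delta)\, d\gamma$. Then $g(e) \ge 0$ for all $e \in \mathbb{R}$, and $g(e) = 0$ if and only if $e = \Delta/k$. -/
/-- The saturation function `sat σ y`. -/
noncomputable def sat (σ y : ℝ) : ℝ := if |y| > σ then σ * Real.sign y else y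

lemma sat_eq_max_min {σ : ℝ} (hσ : 0 < σ) (y : ℝ) : sat σ y = max (-σ) (min σ y) := by
  unfold sat
  split_ifs with h
  · rcases lt_abs.mp h with h | h
    · rw [Real.sign_of_pos (hσ.trans h), min_eq_left h.le, max_eq_right (by linarith), mul_one]
    · rw [Real.sign_of_neg (by linarith), min_eq_right (by linarith), max_eq_left (by linarith),
        mul_neg_one]
  · obtain ⟨h₁, h₂⟩ := abs_le.mp (not_lt.mp h)
    rw [min_eq_right h₂, max_eq_right h₁]

lemma continuous_sat {σ : ℝ} (hσ : 0 < σ) : Continuous (sat σ) := by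
  rw [funext (sat_eq_max_min hσ)]
  fun_prop

lemma lt_sat {σ c y : ℝ} (hσ : 0 < σ) (hc : c < σ) (hy : c < y) : c < sat σ y := by
  rw [sat_eq_max_min hσ]
  exact lt_max_of_lt_right (lt_min hc hy)

lemma sat_lt {σ c y : ℝ} (hσ : 0 < σ) (hc : -σ < c) (hy : y < c) : sat σ y < c := by
  rw [sat_eq_max_min hσ]
  exact max_lt hc (min_lt_of_right_lt hy)

lemma integral_sat_pos {k σ Δ : ℝ} (hk : 0 < k) (hσ : 0 < σ) (hΔ : |Δ| < k * σ) {e : ℝ}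
    (he : e ≠ Δ / k) : 0 < ∫ γ in (Δ / k)..e, (k * sat σ γ - Δ) := by
  have hcont : Continuous fun γ => k * sat σ γ - Δ :=
    ((continuous_sat hσ).const_mul k).sub continuous_const
  obtain ⟨h₁, h₂⟩ := abs_lt.mp hΔ
  rcases he.lt_or_gt with h | h
  · rw [intervalIntegral.integral_symm, ← intervalIntegral.integral_neg]
    refine intervalIntegral.intervalIntegral_pos_of_pos_on
      (hcont.neg.intervalIntegrable _ _) (fun γ hγ => ?_) h
    have hlt := (lt_div_iff₀' hk).mp
      (sat_lt hσ ((lt_div_iff₀' hk).mpr (by linarith)) hγ.2)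
    linarith
  · refine intervalIntegral.intervalIntegral_pos_of_pos_on
      (hcont.intervalIntegrable _ _) (fun γ hγ => ?_) h
    have hlt := (div_lt_iff₀' hk).mp (lt_sat hσ ((div_lt_iff₀' hk).mpr h₂) hγ.1)
    linarith

theorem stmt4 (k σ Δ : ℝ) (hk : 0 < k) (hσ : 0 < σ) (hΔ : |Δ| < k * σ) :
    (∀ e : ℝ, 0 ≤ ∫ γ in (Δ / k)..e, (k * sat σ γ - Δ)) ∧
    (∀ e : ℝ, (∫ γ in (Δ / k)..e, (k * sat σ γ - Δ)) = 0 ↔ e = Δ / k) := by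
  refine ⟨fun e => ?_, fun e => ⟨fun h => ?_, fun h => ?_⟩⟩
  · rcases eq_or_ne e (Δ / k) with rfl | he
    · rw [intervalIntegral.integral_same]
    · exact (integral_sat_pos hk hσ hΔ he).le
  · by_contra he
    exact (integral_sat_pos hk hσ hΔ he).ne' h
  · rw [h, intervalIntegral.integral_same]
end

section
/- Let $k_{tp} > 0$, $k_{td} > 0$, and let $c_1$ satisfy $0 < c_1 < \tfrac{4 k_{tp} k_{td}}{k_{td}^2 + 4 k_{tp}}$. Then the symmetric matrix $W_1 = \tfrac{1}{2}\begin{pmatrix} c_1 k_{tp} & -\tfrac{1}{2} c_1 k_{td} \\ -\tfrac{1}{2} c_1 k_{td} & k_{td} - c_1 \end{pmatrix}$ is positive definite. -/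
open Matrix

theorem stmt6 (ktp ktd c1 : ℝ) (hktp : 0 < ktp) (hktd : 0 < ktd)
    (hc1pos : 0 < c1) (hc1 : c1 < 4 * ktp * ktd / (ktd ^ 2 + 4 * ktp)) :
    let W1 : Matrix (Fin 2) (Fin 2) ℝ :=
      (1/2 : ℝ) • !![c1 * ktp, -(1/2) * c1 * ktd; -(1/2) * c1 * ktd, ktd - c1]
    ∀ z : Fin 2 → ℝ, z ≠ 0 → 0 < z ⬝ᵥ W1.mulVec z := by
  intro W1 z hz
  rw [lt_div_iff₀ (by positivity)] at hc1
  have hdet : 0 < 4 * ktp * (ktd - c1) - c1 * ktd ^ 2 := by linarith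
  have hsquare : 8 * ktp * (z ⬝ᵥ W1.mulVec z) =
      c1 * (2 * ktp * z 0 - ktd * z 1) ^ 2 +
        (4 * ktp * (ktd - c1) - c1 * ktd ^ 2) * z 1 ^ 2 := by
    simp [W1, Matrix.mulVec, dotProduct, Fin.sum_univ_two]
    ring
  refine pos_of_mul_pos_right (a := 8 * ktp) ?_ (by positivity)
  rw [hsquare]
  by_cases h1 : z 1 = 0
  · have h0 : z 0 ≠ 0 := by
      intro h0
      apply hz
      ext i
      fin_cases i
      · exact h0
      · exact h1
    rw [h1]
    have : 0 < c1 * (2 * ktp * z 0) ^ 2 := by positivity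
    simpa using this
  · positivity
end

section
/- Let $J$ be a symmetric positive-definite $3\times 3$ real matrix with smallest and largest eigenvalues $\lambda_{\min}(J) > 0$ and $\lambda_{\max}(J)$, let $k_{rp} > 0$, $k_{rd} > 0$, and let $c_2$ satisfy $0 < c_2 < \tfrac{4 \lambda_{\min}(J)^2 k_{rp} k_{rd}}{4 k_{rp} \lambda_{\min}(J)^2 + k_{rd}^2 \lambda_{\max}(J)}$. Then the symmetric matrix $W_2 = \tfrac{1}{2}\begin{pmatrix} \tfrac{c_2 k_{rp}}{\lambda_{\max}(J)} & -\tfrac{c_2 k_{rd}}{2 \lambda_{\min}(J)} \\ -\tfrac{c_2 k_{rd}}{2 \lambda_{\min}(J)} & k_{rd} - c_2 \end{pmatrix}$ is positive definite. -/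
open Matrix

theorem two_by_two_posDef_of_det_pos {a b d : ℝ} (ha : 0 < a) (hdet : b ^ 2 < a * d)
    {z : Fin 2 → ℝ} (hz : z ≠ 0) : 0 < z ⬝ᵥ !![a, b; b, d].mulVec z := by
  have hform : a * (z ⬝ᵥ !![a, b; b, d].mulVec z)
      = (a * z 0 + b * z 1) ^ 2 + (a * d - b ^ 2) * z 1 ^ 2 := by
    simp [dotProduct, mulVec, Fin.sum_univ_two]
    ring
  refine pos_of_mul_pos_right (b := z ⬝ᵥ !![a, b; b, d].mulVec z) (a := a) ?_ ha.le
  rw [hform]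
  by_cases h1 : z 1 = 0
  · have h0 : z 0 ≠ 0 := by
      intro h0
      exact hz (funext (Fin.forall_fin_two.2 ⟨h0, h1⟩))
    simp only [h1, mul_zero, add_zero, zero_pow two_ne_zero]
    positivity
  · have : 0 < a * d - b ^ 2 := sub_pos.2 hdet
    positivity

theorem stmt7 (J : Matrix (Fin 3) (Fin 3) ℝ) (hJsym : J.IsSymm)
    (hJpd : ∀ v : Fin 3 → ℝ, v ≠ 0 → 0 < v ⬝ᵥ J.mulVec v)
    (lmin lmax : ℝ) (hlminpos : 0 < lmin)
    -- `lmin` is the smallest eigenvalue of `J`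
    (hlmin_le : ∀ v : Fin 3 → ℝ, lmin * (v ⬝ᵥ v) ≤ v ⬝ᵥ J.mulVec v)
    (hlmin_eig : ∃ v : Fin 3 → ℝ, v ≠ 0 ∧ J.mulVec v = lmin • v)
    -- `lmax` is the largest eigenvalue of `J`
    (hlmax_ge : ∀ v : Fin 3 → ℝ, v ⬝ᵥ J.mulVec v ≤ lmax * (v ⬝ᵥ v))
    (hlmax_eig : ∃ v : Fin 3 → ℝ, v ≠ 0 ∧ J.mulVec v = lmax • v)
    (krp krd c2 : ℝ) (hkrp : 0 < krp) (hkrd : 0 < krd) (hc2pos : 0 < c2)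
    (hc2 : c2 < 4 * lmin ^ 2 * krp * krd / (4 * krp * lmin ^ 2 + krd ^ 2 * lmax)) :
    let W2 : Matrix (Fin 2) (Fin 2) ℝ :=
      (1/2 : ℝ) • !![c2 * krp / lmax, -(c2 * krd / (2 * lmin));
                     -(c2 * krd / (2 * lmin)), krd - c2]
    ∀ z : Fin 2 → ℝ, z ≠ 0 → 0 < z ⬝ᵥ W2.mulVec z := by
  intro W2 z hz
  have hlmax : 0 < lmax := by
    obtain ⟨v, hv, hJv⟩ := hlmax_eig
    have h := hJpd v hv
    rw [hJv, dotProduct_smul, smul_eq_mul] at h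
    exact pos_of_mul_pos_left h (dotProduct_self_star_nonneg v)
  rw [lt_div_iff₀ (by positivity)] at hc2
  rw [show z ⬝ᵥ W2.mulVec z = 1 / 2 * _ by
    rw [smul_mulVec, dotProduct_smul, smul_eq_mul]]
  refine mul_pos one_half_pos (two_by_two_posDef_of_det_pos (by positivity) ?_ hz)
  have hdiff : c2 * krp / lmax * (krd - c2) - (-(c2 * krd / (2 * lmin))) ^ 2
      = c2 * (4 * lmin ^ 2 * krp * krd - c2 * (4 * krp * lmin ^ 2 + krd ^ 2 * lmax))
        / (4 * lmin ^ 2 * lmax) := by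
    field_simp
    ring
  rw [← sub_pos, hdiff]
  have := sub_pos.2 hc2
  positivity
end

section
/- Let $Q \in SO(3)$ and define $C(Q) = \tfrac{1}{2}\big(\operatorname{tr}(Q) I_3 - Q\big)$. Then for every $x \in \mathbb{R}^3$, $\|C(Q)\,x\| \le \|x\|$. -/
open Matrix

/-- Rank-one identity for a rotation `Q` with trace `t` and axial vector `w`, as quadratic forms:
`(1 - t²) ‖x‖² + 2 (t + 1) ⟪x, Q x⟫ = ⟪w, x⟫²`. -/
theorem rotation_quadratic_identity (Q : Matrix (Fin 3) (Fin 3) ℝ) (hQ : Qᵀ * Q = 1)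
    (hdet : Q.det = 1) (x : Fin 3 → ℝ) :
    (1 - Q.trace ^ 2) * (x ⬝ᵥ x) + 2 * (Q.trace + 1) * (x ⬝ᵥ Q *ᵥ x) =
      (![Q 2 1 - Q 1 2, Q 0 2 - Q 2 0, Q 1 0 - Q 0 1] ⬝ᵥ x) ^ 2 := by
  have hQ' : Q * Qᵀ = 1 := mul_eq_one_comm.mp hQ
  have hadj : Q.adjugate = Qᵀ := by
    have h : Q.adjugate * Q = 1 := by rw [adjugate_mul, hdet, one_smul]
    calc Q.adjugate = Q.adjugate * (Q * Qᵀ) := by rw [hQ', mul_one]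
      _ = Qᵀ := by rw [← mul_assoc, h, one_mul]
  have col (i j : Fin 3) := congrFun (congrFun hQ i) j
  have row (i j : Fin 3) := congrFun (congrFun hQ' i) j
  have cof (i j : Fin 3) := congrFun (congrFun hadj i) j
  have c00 := col 0 0
  have c11 := col 1 1
  have c22 := col 2 2
  have c01 := col 0 1
  have c02 := col 0 2
  have c12 := col 1 2
  have r00 := row 0 0
  have r11 := row 1 1
  have r22 := row 2 2
  have r01 := row 0 1
  have r02 := row 0 2
  have r12 := row 1 2
  have a00 := cof 0 0
  have a11 := cof 1 1
  have a22 := cof 2 2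
  have a01 := cof 0 1
  have a10 := cof 1 0
  have a02 := cof 0 2
  have a20 := cof 2 0
  have a12 := cof 1 2
  have a21 := cof 2 1
  simp [mul_apply, Fin.sum_univ_three] at c00 c11 c22 c01 c02 c12 r00 r11 r22 r01 r02 r12
  simp [adjugate_fin_three] at a00 a11 a22 a01 a10 a02 a20 a12 a21
  simp only [trace, diag, dotProduct, mulVec, Fin.sum_univ_three, cons_val]
  generalize Q 0 0 = a at *
  generalize Q 0 1 = b at *
  generalize Q 0 2 = c at *
  generalize Q 1 0 = d at *
  generalize Q 1 1 = e at *
  generalize Q 1 2 = f at *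
  generalize Q 2 0 = g at *
  generalize Q 2 1 = h at *
  generalize Q 2 2 = i at *
  have d0 : 1 - (a+e+i)^2 + 2*(a+e+i+1)*a = (h-f)^2 := by linarith
  have d1 : 1 - (a+e+i)^2 + 2*(a+e+i+1)*e = (c-g)^2 := by linarith
  have d2 : 1 - (a+e+i)^2 + 2*(a+e+i+1)*i = (d-b)^2 := by linarith
  have o01 : (a+e+i+1)*(b+d) = (h-f)*(c-g) := by linarith
  have o02 : (a+e+i+1)*(c+g) = (h-f)*(d-b) := by linarith
  have o12 : (a+e+i+1)*(f+h) = (c-g)*(d-b) := by linarith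
  linear_combination x 0 ^ 2 * d0 + x 1 ^ 2 * d1 + x 2 ^ 2 * d2 + 2 * x 0 * x 1 * o01
    + 2 * x 0 * x 2 * o02 + 2 * x 1 * x 2 * o12

theorem stmt9 (Q : Matrix (Fin 3) (Fin 3) ℝ) (hQ : Qᵀ * Q = 1) (hdet : Q.det = 1) :
    let C : Matrix (Fin 3) (Fin 3) ℝ :=
      (1/2 : ℝ) • (Matrix.trace Q • (1 : Matrix (Fin 3) (Fin 3) ℝ) - Q)
    ∀ x : Fin 3 → ℝ, norm3 (C.mulVec x) ≤ norm3 x := by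
  intro C x
  have key := rotation_quadratic_identity Q hQ hdet x
  have hiso : Q *ᵥ x ⬝ᵥ Q *ᵥ x = x ⬝ᵥ x := by
    rw [dotProduct_mulVec, vecMul_mulVec, hQ, vecMul_one]
  have hcomm := dotProduct_comm (Q *ᵥ x) x
  have hCS : 0 ≤ (x - Q *ᵥ x) ⬝ᵥ (x - Q *ᵥ x) :=
    Finset.sum_nonneg fun _ _ => mul_self_nonneg _
  have hC : C *ᵥ x = (1 / 2 : ℝ) • (Q.trace • x - Q *ᵥ x) := by
    simp only [C, smul_mulVec, sub_mulVec, one_mulVec]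
  apply Real.sqrt_le_sqrt
  rw [hC]
  simp only [sub_dotProduct, dotProduct_sub, smul_dotProduct, dotProduct_smul, smul_eq_mul,
    hiso, hcomm] at hCS ⊢
  linarith [sq_nonneg (![Q 2 1 - Q 1 2, Q 0 2 - Q 2 0, Q 1 0 - Q 0 1] ⬝ᵥ x)]
end

section
/- (Theorem 2 of the paper, dissipation inequality under actuator uncertainty.) Let $k_\mu > 0$, $\gamma \in (0, 1]$, and nonnegative constants $M_0, M_1, M_2, D$, and let $W_1, W_2$ be symmetric positive-definite $2\times 2$ real matrices with smallest eigenvalues $\lambda_{\min}(W_1), \lambda_{\min}(W_2)$. Suppose a differentiable function $V : \mathbb{R} \to \mathbb{R}$ and functions $e_\mu : \mathbb{R} \to \mathbb{R}^6$, $z_1, z_2 : \mathbb{R} \to \mathbb{R}^2$ with nonnegative components satisfy, for all $t$, $\dot{V} \le -k_\mu \gamma \|e_\mu\|^2 + \|e_\mu\| D + (1-\gamma)\|e_\mu\|\big(M_0 + M_1\|z_1\| + M_2\|z_2\|\big) - z_1^\top W_1 z_1 - z_2^\top W_2 z_2$. If $k_\mu > \tfrac{(1-\gamma)^2}{\gamma}\max\Big\{\tfrac{M_1^2}{\lambda_{\min}(W_1)},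 \tfrac{M_2^2}{\lambda_{\min}(W_2)}\Big\}$ and additionally $k_\mu\gamma$ is large enough that $\beta_2 := \lambda_{\min}(W_1) - \tfrac{4(1-\gamma)^2 M_1^2}{k_\mu\gamma} > 0$ and $\beta_3 := \lambda_{\min}(W_2) - \tfrac{4(1-\gamma)^2 M_2^2}{k_\mu\gamma} > 0$, then for all $t$, $\dot{V}(t) \le -\beta_1\|e_\mu(t)\|^2 - \beta_2\|z_1(t)\|^2 - \beta_3\|z_2(t)\|^2 + \beta_4$, where $\beta_1 = \tfrac{1}{2}k_\mu\gamma$ and $\beta_4 = \tfrac{4\big(D^2 + (1-\gamma)^2 M_0^2\big)}{k_\mu\gamma}$. In particular, $\dot{V}(t) < 0$ whenever $\beta_1\|e_\mu(t)\|^2 + \beta_2\|z_1(t)\|^2 + \beta_3\|z_2(t)\|^2 > \beta_4$, so trajectories along which $V$ dominates a positive-definite quadratic form of $(e_\mu, z_1, z_2)$ remain bounded. -/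
open Matrix

/-- Euclidean norm of a vector in `ℝ⁶`. -/
noncomputable def norm6 (v : Fin 6 → ℝ) : ℝ := Real.sqrt (v ⬝ᵥ v)

/-- Euclidean norm of a vector in `ℝ²`. -/
noncomputable def norm2 (v : Fin 2 → ℝ) : ℝ := Real.sqrt (v ⬝ᵥ v)

/-- Young's inequality with weight `a / 8`, with a non-sharp constant in the second term. -/
theorem mul_le_weighted_sq_add_sq_div {a : ℝ} (ha : 0 < a) (x c : ℝ) :
    x * c ≤ a / 8 * x ^ 2 + 4 * c ^ 2 / a := by
  have h : a / 8 * x ^ 2 + 4 * c ^ 2 / a - x * c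
      = ((a * x - 4 * c) ^ 2 + 16 * c ^ 2) / (8 * a) := by
    field_simp
    ring
  have h' : 0 ≤ ((a * x - 4 * c) ^ 2 + 16 * c ^ 2) / (8 * a) := by positivity
  linarith

theorem norm2_sq (v : Fin 2 → ℝ) : norm2 v ^ 2 = v ⬝ᵥ v :=
  Real.sq_sqrt (Finset.sum_nonneg fun i _ => mul_self_nonneg (v i))

theorem stmt19 (kμ γ M0 M1 M2 D : ℝ)
    (hkμ : 0 < kμ) (hγ0 : 0 < γ) (hγ1 : γ ≤ 1)
    (hM0 : 0 ≤ M0) (hM1 : 0 ≤ M1) (hM2 : 0 ≤ M2) (hD : 0 ≤ D)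
    (W1 W2 : Matrix (Fin 2) (Fin 2) ℝ) (hW1sym : W1.IsSymm) (hW2sym : W2.IsSymm)
    (hW1pd : ∀ z : Fin 2 → ℝ, z ≠ 0 → 0 < z ⬝ᵥ W1.mulVec z)
    (hW2pd : ∀ z : Fin 2 → ℝ, z ≠ 0 → 0 < z ⬝ᵥ W2.mulVec z)
    (lW1 lW2 : ℝ)
    -- `lW1` is the smallest eigenvalue of `W1`
    (hlW1_le : ∀ z : Fin 2 → ℝ, lW1 * (z ⬝ᵥ z) ≤ z ⬝ᵥ W1.mulVec z)
    (hlW1_eig : ∃ z : Fin 2 → ℝ, z ≠ 0 ∧ W1.mulVec z = lW1 • z)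
    -- `lW2` is the smallest eigenvalue of `W2`
    (hlW2_le : ∀ z : Fin 2 → ℝ, lW2 * (z ⬝ᵥ z) ≤ z ⬝ᵥ W2.mulVec z)
    (hlW2_eig : ∃ z : Fin 2 → ℝ, z ≠ 0 ∧ W2.mulVec z = lW2 • z)
    (V dV : ℝ → ℝ) (hV : ∀ t, HasDerivAt V (dV t) t)
    (eμ : ℝ → Fin 6 → ℝ) (z1 z2 : ℝ → Fin 2 → ℝ)
    (hz1 : ∀ t i, 0 ≤ z1 t i) (hz2 : ∀ t i, 0 ≤ z2 t i)
    (hineq : ∀ t, dV t ≤ -(kμ * γ) * norm6 (eμ t) ^ 2 + norm6 (eμ t) * D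
      + (1 - γ) * norm6 (eμ t) * (M0 + M1 * norm2 (z1 t) + M2 * norm2 (z2 t))
      - z1 t ⬝ᵥ W1.mulVec (z1 t) - z2 t ⬝ᵥ W2.mulVec (z2 t))
    (hkμbig : kμ > (1 - γ) ^ 2 / γ * max (M1 ^ 2 / lW1) (M2 ^ 2 / lW2))
    (hβ2 : 0 < lW1 - 4 * (1 - γ) ^ 2 * M1 ^ 2 / (kμ * γ))
    (hβ3 : 0 < lW2 - 4 * (1 - γ) ^ 2 * M2 ^ 2 / (kμ * γ)) :
    let β1 : ℝ := (1/2) * kμ * γ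
    let β2 : ℝ := lW1 - 4 * (1 - γ) ^ 2 * M1 ^ 2 / (kμ * γ)
    let β3 : ℝ := lW2 - 4 * (1 - γ) ^ 2 * M2 ^ 2 / (kμ * γ)
    let β4 : ℝ := 4 * (D ^ 2 + (1 - γ) ^ 2 * M0 ^ 2) / (kμ * γ)
    ∀ t, dV t ≤ -β1 * norm6 (eμ t) ^ 2 - β2 * norm2 (z1 t) ^ 2
        - β3 * norm2 (z2 t) ^ 2 + β4 ∧
      (β4 < β1 * norm6 (eμ t) ^ 2 + β2 * norm2 (z1 t) ^ 2 + β3 * norm2 (z2 t) ^ 2 →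
        dV t < 0) := by
  intro β1 β2 β3 β4 t
  have ha : 0 < kμ * γ := mul_pos hkμ hγ0
  have key : dV t ≤ -β1 * norm6 (eμ t) ^ 2 - β2 * norm2 (z1 t) ^ 2
      - β3 * norm2 (z2 t) ^ 2 + β4 := by
    have h := hineq t
    have hW1 := hlW1_le (z1 t)
    have hW2 := hlW2_le (z2 t)
    rw [← norm2_sq] at hW1 hW2
    simp only [β1, β2, β3, β4]
    generalize norm6 (eμ t) = x at *
    generalize norm2 (z1 t) = y at *
    generalize norm2 (z2 t) = w at *
    have hD' := mul_le_weighted_sq_add_sq_div ha x D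
    have hM0' := mul_le_weighted_sq_add_sq_div ha x ((1 - γ) * M0)
    have hM1' := mul_le_weighted_sq_add_sq_div ha x ((1 - γ) * M1 * y)
    have hM2' := mul_le_weighted_sq_add_sq_div ha x ((1 - γ) * M2 * w)
    simp only [div_eq_mul_inv] at *
    linarith
  exact ⟨key, fun hlt => by linarith⟩
end
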